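/- Let K be an imaginary quadratic field, O an order in K of conductor ℓ_O, and N a positive integer. The map φ : 𝔞 ↦ 𝔞O_K sends M(O, ℓ_O N) into M(O_K, ℓ_O N), is multiplicative, and is a bijection with inverse 𝔟 ↦ 𝔟 ∩ O; moreover φ extends uniquely to a group isomorphism I(O, ℓ_O N) ≅ I(O_K, ℓ_O N), given by 𝔞𝔠⁻¹ ↦ (𝔞O_K)(𝔠O_K)⁻¹ for 𝔞, 𝔠 ∈ M(O, ℓ_O N). -/

import Mathlib

open scoped nonZeroDivisors

set_option synthInstance.maxHeartbeats 1000000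
set_option maxHeartbeats 1000000

noncomputable section

variable (K : Type) [Field K] [NumberField K]

/-- The fractional `O`-ideals of `K` (for `O` a subring of `K`). -/
abbrev Frac (O : Subalgebra ℤ K) := FractionalIdeal ((O : Type))⁰ K

/-- A nonzero ideal `a` of `O` is *prime to* `m` if `a + mO = O`. -/
def primeTo (O : Subalgebra ℤ K) (m : ℕ) (a : Ideal O) : Prop :=
  a ⊔ Ideal.span {(m : O)} = ⊤

/-- `M(O, m)`: the nonzero proper (equivalently, invertible) `O`-ideals prime to `m`. -/
def Mset (O : Subalgebra ℤ K) (m : ℕ) : Set (Ideal O) :=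
  {a | a ≠ 0 ∧ primeTo K O m a ∧ IsUnit (a : Frac K O)}

/-- `I(O, m)`: the subgroup of the group of invertible fractional `O`-ideals generated by
`M(O, m)`. -/
def Igrp (O : Subalgebra ℤ K) (m : ℕ) : Subgroup (Frac K O)ˣ :=
  Subgroup.closure {u | ∃ a ∈ Mset K O m, (u : Frac K O) = a}

/-- `O` is an order of the imaginary quadratic field `K`:  `K` has degree 2 over `ℚ`, has no
real embeddings, and `O` is a subring of `K` which is finitely generated as a ℤ-module and
contains a ℚ-basis of `K` (i.e. spans `K` over ℚ). -/
structure IsImagQuadOrder (O : Subalgebra ℤ K) : Prop where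
  degree_two : Module.finrank ℚ K = 2
  no_real_embedding : ∀ v : NumberField.InfinitePlace K, v.IsComplex
  fg : (Subalgebra.toSubmodule O).FG
  spans : Submodule.span ℚ (O : Set K) = ⊤

/-- The extension `𝔞 ↦ 𝔞O_K` of an ideal of `O` to the maximal order: the ideal of
`O_K = integralClosure ℤ K` generated by (the image in `O_K` of) `𝔞`. -/
def extIdeal (O : Subalgebra ℤ K) (a : Ideal O) : Ideal (integralClosure ℤ K) :=
  Ideal.span {x : ((integralClosure ℤ K : Subalgebra ℤ K) : Type) |
    (x : K) ∈ Subtype.val '' (a : Set (O : Type))}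

/-!
STATEMENT 5: the map `φ : 𝔞 ↦ 𝔞O_K` sends `M(O, ℓ_O N)` into `M(O_K, ℓ_O N)`, is
multiplicative, and is a bijection whose inverse is `𝔟 ↦ 𝔟 ∩ O`; moreover `φ` extends
uniquely to a group isomorphism `I(O, ℓ_O N) ≅ I(O_K, ℓ_O N)`, given by
`𝔞𝔠⁻¹ ↦ (𝔞O_K)(𝔠O_K)⁻¹` for `𝔞, 𝔠 ∈ M(O, ℓ_O N)`.
-/

/-- The conductor `ℓ_O = [O_K : O]`, as the index of `O` in the maximal order as additive
subgroups of `K`. -/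
def condOrder (O : Subalgebra ℤ K) : ℕ :=
  AddSubgroup.relIndex (Subalgebra.toSubmodule O).toAddSubgroup
    (Subalgebra.toSubmodule (integralClosure ℤ K)).toAddSubgroup

section ConductorIdeals

variable {A B : Type*} [CommRing A] [CommRing B] {f : A →+* B} {m : A}

theorem Ideal.map_sup_span_singleton_eq_top {a : Ideal A} (ha : a ⊔ Ideal.span {m} = ⊤) :
    a.map f ⊔ Ideal.span {f m} = ⊤ := by
  have h := congrArg (Ideal.map f) ha
  rwa [Ideal.map_sup, Ideal.map_span, Set.image_singleton, Ideal.map_top] at h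

/-- If `m` multiplies `B` into `A`, it multiplies `𝔞B` into `𝔞`. -/
theorem Ideal.exists_mem_map_eq_mul (hm : ∀ b : B, ∃ a : A, f a = f m * b) (a : Ideal A) {y : B}
    (hy : y ∈ a.map f) : ∃ z ∈ a, f z = f m * y := by
  obtain ⟨n, c, x, rfl⟩ := Submodule.mem_span_set'.mp hy
  choose s hs using hm
  choose t ht hft using fun i => (x i).2
  refine ⟨∑ i, s (c i) * t i, a.sum_mem fun i _ => a.mul_mem_left _ (ht i), ?_⟩
  rw [map_sum, Finset.mul_sum]
  refine Finset.sum_congr rfl fun i _ => ?_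
  rw [map_mul, hs, hft, smul_eq_mul, mul_assoc]

theorem Ideal.comap_map_eq_of_sup_span_singleton_eq_top (hf : Function.Injective f)
    (hm : ∀ b : B, ∃ a : A, f a = f m * b) {a : Ideal A} (ha : a ⊔ Ideal.span {m} = ⊤) :
    (a.map f).comap f = a := by
  refine le_antisymm (fun x hx => ?_) Ideal.le_comap_map
  obtain ⟨α, hα, t, ht, h⟩ := Submodule.mem_sup.mp ((Ideal.eq_top_iff_one _).mp ha)
  obtain ⟨s, rfl⟩ := Ideal.mem_span_singleton'.mp ht
  obtain ⟨z, hz, e⟩ := Ideal.exists_mem_map_eq_mul hm a hx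
  rw [← map_mul] at e
  obtain rfl := hf e
  have : x = x * α + s * (m * x) := by linear_combination (-x) * h
  rw [this]
  exact a.add_mem (a.mul_mem_left _ hα) (a.mul_mem_left _ hz)

theorem Ideal.comap_sup_span_singleton_eq_top
    (hm : ∀ b : B, ∃ a : A, f a = f m * b) {b : Ideal B} (hb : b ⊔ Ideal.span {f m} = ⊤) :
    b.comap f ⊔ Ideal.span {m} = ⊤ := by
  obtain ⟨β, hβ, t, ht, h⟩ := Submodule.mem_sup.mp ((Ideal.eq_top_iff_one _).mp hb)
  obtain ⟨t, rfl⟩ := Ideal.mem_span_singleton'.mp ht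
  obtain ⟨s, hs⟩ := hm (t * t)
  rw [Ideal.eq_top_iff_one]
  refine Submodule.mem_sup.mpr ⟨1 - m * s, ?_, m * s, Ideal.mul_mem_right _ _
    (Ideal.mem_span_singleton_self m), sub_add_cancel _ _⟩
  have : f (1 - m * s) = (β + 2 * (t * f m)) * β := by
    rw [map_sub, map_one, map_mul, hs]
    linear_combination (-(β + t * f m + 1)) * h
  rw [Ideal.mem_comap, this]
  exact b.mul_mem_left _ hβ

theorem Ideal.map_comap_eq_of_sup_span_singleton_eq_top
    (hm : ∀ b : B, ∃ a : A, f a = f m * b) {b : Ideal B} (hb : b ⊔ Ideal.span {f m} = ⊤) :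
    (b.comap f).map f = b := by
  refine le_antisymm Ideal.map_comap_le (fun x hx => ?_)
  obtain ⟨α, hα, t, ht, h⟩ := Submodule.mem_sup.mp
    ((Ideal.eq_top_iff_one _).mp (Ideal.comap_sup_span_singleton_eq_top hm hb))
  obtain ⟨s, rfl⟩ := Ideal.mem_span_singleton'.mp ht
  obtain ⟨z, hz⟩ := hm x
  have hzb : z ∈ b.comap f := by
    rw [Ideal.mem_comap, hz]
    exact b.mul_mem_left _ hx
  have : x = x * f α + f s * f z := by
    have := congrArg f h
    rw [map_add, map_mul, map_one] at this
    rw [hz]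
    linear_combination (-x) * this
  rw [this]
  exact add_mem (Ideal.mul_mem_left _ _ (Ideal.mem_map_of_mem f hα))
    (Ideal.mul_mem_left _ _ (Ideal.mem_map_of_mem f hzb))

theorem Ideal.comap_ne_zero_of_sup_span_singleton_eq_top
    (hm : ∀ b : B, ∃ a : A, f a = f m * b) {b : Ideal B} (hb : b ⊔ Ideal.span {f m} = ⊤)
    (hb0 : b ≠ 0) : b.comap f ≠ 0 := by
  intro h
  rw [← Ideal.map_comap_eq_of_sup_span_singleton_eq_top hm hb, h] at hb0
  exact hb0 Ideal.map_bot

theorem Ideal.sup_span_singleton_mul_eq_top {a b : Ideal A} (ha : a ⊔ Ideal.span {m} = ⊤)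
    (hb : b ⊔ Ideal.span {m} = ⊤) : a * b ⊔ Ideal.span {m} = ⊤ :=
  Ideal.isCoprime_iff_sup_eq.mp
    ((Ideal.isCoprime_iff_sup_eq.mpr ha).mul_left (Ideal.isCoprime_iff_sup_eq.mpr hb))

/-- Contraction along `A → B` preserves invertibility of ideals prime to an element `m` with
`mB ⊆ A`. -/
theorem Ideal.isUnit_comap_of_sup_span_singleton_eq_top [IsDomain A] [IsDomain B]
    {K : Type*} [Field K] [Algebra A K] [IsFractionRing A K] [Algebra B K] [IsFractionRing B K]
    (hK : ∀ a : A, algebraMap B K (f a) = algebraMap A K a)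
    (hm : ∀ b : B, ∃ a : A, f a = f m * b) {b : Ideal B} (hb : b ⊔ Ideal.span {f m} = ⊤)
    (hb0 : b ≠ 0) (hu : IsUnit (b : FractionalIdeal B⁰ K)) :
    IsUnit ((b.comap f : Ideal A) : FractionalIdeal A⁰ K) := by
  set a := b.comap f with ha
  have ha0 : (a : FractionalIdeal A⁰ K) ≠ 0 :=
    FractionalIdeal.coeIdeal_ne_zero.mpr
      (Ideal.comap_ne_zero_of_sup_span_singleton_eq_top hm hb hb0)
  have hb0' : (b : FractionalIdeal B⁰ K) ≠ 0 := FractionalIdeal.coeIdeal_ne_zero.mpr hb0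
  obtain ⟨c, hc⟩ := FractionalIdeal.le_one_iff_exists_coeIdeal.mp
    (FractionalIdeal.mul_one_div_le_one (I := (a : FractionalIdeal A⁰ K)))
  rw [← FractionalIdeal.inv_eq] at hc
  have key : ∀ z ∈ (b : FractionalIdeal B⁰ K) * (b : FractionalIdeal B⁰ K)⁻¹,
      algebraMap A K m * algebraMap A K m * z ∈
        (a : FractionalIdeal A⁰ K) * (a : FractionalIdeal A⁰ K)⁻¹ := by
    intro z hz
    refine FractionalIdeal.mul_induction_on hz (fun x hxb y hy => ?_) (fun x y hx hy => ?_)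
    · obtain ⟨x, hx, rfl⟩ := (FractionalIdeal.mem_coeIdeal _).mp hxb
      obtain ⟨x', hx'⟩ := hm x
      rw [mul_mul_mul_comm]
      refine FractionalIdeal.mul_mem_mul ?_ ?_
      · refine (FractionalIdeal.mem_coeIdeal _).mpr ⟨x', ?_, ?_⟩
        · rw [ha, Ideal.mem_comap, hx']
          exact b.mul_mem_left _ hx
        · rw [← hK, hx', map_mul, hK]
      · rw [FractionalIdeal.mem_inv_iff ha0]
        intro w hwa
        obtain ⟨w, hw, rfl⟩ := (FractionalIdeal.mem_coeIdeal _).mp hwa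
        obtain ⟨v, hv⟩ := (FractionalIdeal.mem_one_iff _).mp
          ((FractionalIdeal.mem_inv_iff hb0').mp hy _ (FractionalIdeal.mem_coeIdeal_of_mem _ hw))
        obtain ⟨v', hv'⟩ := hm v
        refine (FractionalIdeal.mem_one_iff _).mpr ⟨v', ?_⟩
        rw [← hK, hv', map_mul, hv, hK, hK, mul_assoc]
    · rw [mul_add]
      exact Submodule.add_mem (_ : Submodule A K) hx hy
  have hmc : m * m ∈ c := by
    have := key 1 (by
      rw [(FractionalIdeal.mul_inv_cancel_iff_isUnit K).mpr hu]
      exact FractionalIdeal.one_mem_one _)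
    rw [mul_one, ← map_mul, ← hc] at this
    obtain ⟨y, hy, e⟩ := (FractionalIdeal.mem_coeIdeal _).mp this
    rwa [← IsFractionRing.injective A K e]
  have hac : a ≤ c := by
    rw [← FractionalIdeal.coeIdeal_le_coeIdeal K, hc]
    exact FractionalIdeal.coe_ideal_le_self_mul_inv K a
  have htop : c = ⊤ := by
    have hco := Ideal.comap_sup_span_singleton_eq_top hm hb
    have hcop : IsCoprime a (Ideal.span {m} * Ideal.span {m}) :=
      (Ideal.isCoprime_iff_sup_eq.mpr hco).mul_right (Ideal.isCoprime_iff_sup_eq.mpr hco)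
    rw [Ideal.isCoprime_iff_sup_eq, Ideal.span_singleton_mul_span_singleton] at hcop
    rw [eq_top_iff, ← hcop, sup_le_iff, Ideal.span_singleton_le_iff_mem]
    exact ⟨hac, hmc⟩
  rw [← FractionalIdeal.mul_inv_cancel_iff_isUnit, ← hc, htop, FractionalIdeal.coeIdeal_top]

end ConductorIdeals

section ClosureOfSubmonoid

variable {G H : Type*} [CommGroup G] [CommGroup H]

theorem Submonoid.exists_mul_inv_of_mem_closure (S : Submonoid G) {x : G}
    (hx : x ∈ Subgroup.closure (S : Set G)) : ∃ a ∈ S, ∃ c ∈ S, x = a * c⁻¹ := by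
  induction hx using Subgroup.closure_induction with
  | mem x hx => exact ⟨x, hx, 1, S.one_mem, by simp⟩
  | one => exact ⟨1, S.one_mem, 1, S.one_mem, by simp⟩
  | mul x y _ _ hx hy =>
    obtain ⟨a, ha, c, hc, rfl⟩ := hx
    obtain ⟨a', ha', c', hc', rfl⟩ := hy
    exact ⟨a * a', S.mul_mem ha ha', c * c', S.mul_mem hc hc', by
      rw [mul_inv, mul_mul_mul_comm]⟩
  | inv x _ hx =>
    obtain ⟨a, ha, c, hc, rfl⟩ := hx
    exact ⟨c, hc, a, ha, by rw [mul_inv, inv_inv, mul_comm]⟩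

/-- A homomorphism of commutative groups that maps a submonoid `S` bijectively onto a set `T`
restricts to an isomorphism of the subgroups they generate. -/
theorem MonoidHom.exists_mulEquiv_closure (g : G →* H) (S : Submonoid G) {T : Set H}
    (h : Set.BijOn g S T) :
    ∃ e : Subgroup.closure (S : Set G) ≃* Subgroup.closure T, ∀ x, (e x : H) = g x := by
  have hmap : (Subgroup.closure (S : Set G)).map g = Subgroup.closure T := by
    rw [MonoidHom.map_closure, h.image_eq]
  have hmem : ∀ x : Subgroup.closure (S : Set G), g x ∈ Subgroup.closure T := fun x =>
    hmap ▸ Subgroup.mem_map_of_mem g x.2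
  let g' : Subgroup.closure (S : Set G) →* Subgroup.closure T :=
    (g.comp (Subgroup.subtype _)).codRestrict _ hmem
  refine ⟨MulEquiv.ofBijective g' ⟨?_, ?_⟩, fun x => rfl⟩
  · rw [injective_iff_map_eq_one]
    rintro ⟨x, hx⟩ hgx
    obtain ⟨a, ha, c, hc, rfl⟩ := S.exists_mul_inv_of_mem_closure hx
    have hg : g (a * c⁻¹) = 1 := congrArg Subtype.val hgx
    rw [map_mul, map_inv, mul_inv_eq_one] at hg
    exact Subtype.ext (mul_inv_eq_one.mpr (h.injOn ha hc hg))
  · rintro ⟨y, hy⟩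
    obtain ⟨x, hx, rfl⟩ := hmap ▸ hy
    exact ⟨⟨x, hx⟩, rfl⟩

end ClosureOfSubmonoid

section Subalgebras

variable {L : Type} [Field L] {O : Subalgebra ℤ L}

theorem natCast_condOrder_mul_mem (x : integralClosure ℤ L) (N : ℕ) :
    ((condOrder L O * N : ℕ) : L) * x ∈ O := by
  have h := AddSubgroup.nsmul_index_mem
    ((Subalgebra.toSubmodule O).toAddSubgroup.addSubgroupOf
      (Subalgebra.toSubmodule (integralClosure ℤ L)).toAddSubgroup) x
  have h' : condOrder L O • (x : L) ∈ O := h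
  rw [Nat.cast_mul, mul_comm (_ : L) (N : L), mul_assoc, ← nsmul_eq_mul (condOrder L O)]
  exact mul_mem (natCast_mem O N) h'

theorem extIdeal_eq_map (h : O ≤ integralClosure ℤ L) (a : Ideal O) :
    extIdeal L O a = a.map (Subalgebra.inclusion h).toRingHom := by
  refine congrArg Ideal.span (Set.ext fun x => ?_)
  constructor
  · rintro ⟨y, hy, e⟩
    exact ⟨y, hy, Subtype.ext e⟩
  · rintro ⟨y, hy, rfl⟩
    exact ⟨y, hy, rfl⟩

theorem setOf_mem_image_val_eq_comap (h : O ≤ integralClosure ℤ L)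
    (b : Ideal (integralClosure ℤ L)) :
    {x : (O : Type) | (x : L) ∈ Subtype.val '' (b :
      Set ((integralClosure ℤ L : Subalgebra ℤ L) : Type))} =
      (b.comap (Subalgebra.inclusion h).toRingHom : Ideal O) := by
  ext x
  constructor
  · rintro ⟨y, hy, e⟩
    obtain rfl : y = Subalgebra.inclusion h x := Subtype.ext e
    exact hy
  · intro hx
    exact ⟨_, hx, rfl⟩

end Subalgebras

section Orders

variable {K}
variable {O : Subalgebra ℤ K}

theorem IsImagQuadOrder.le_integralClosure (hO : IsImagQuadOrder K O) :
    O ≤ integralClosure ℤ K := fun _ hx =>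
  IsIntegral.of_mem_of_fg O hO.fg _ hx

theorem IsImagQuadOrder.isFractionRing (hO : IsImagQuadOrder K O) : IsFractionRing O K := by
  have key : ∀ x : K, ∃ n : ℤ, n ≠ 0 ∧ (n : K) * x ∈ O := by
    intro x
    have hx : x ∈ Submodule.span ℚ (O : Set K) := hO.spans ▸ Submodule.mem_top
    induction hx using Submodule.span_induction with
    | mem x hx => exact ⟨1, one_ne_zero, by simpa using hx⟩
    | zero => exact ⟨1, one_ne_zero, by simp⟩
    | add x y _ _ hx hy =>
      obtain ⟨n, hn, hx⟩ := hx
      obtain ⟨k, hk, hy⟩ := hy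
      refine ⟨n * k, mul_ne_zero hn hk, ?_⟩
      have : ((n * k : ℤ) : K) * (x + y) = k * (n * x) + n * (k * y) := by push_cast; ring
      rw [this]
      exact add_mem (mul_mem (intCast_mem O k) hx) (mul_mem (intCast_mem O n) hy)
    | smul q x _ hx =>
      obtain ⟨n, hn, hx⟩ := hx
      refine ⟨q.den * n, mul_ne_zero (mod_cast q.den_nz) hn, ?_⟩
      have : ((q.den * n : ℤ) : K) * (q • x) = q.num * (n * x) := by
        have hq : (q.den : K) * (q : K) = q.num := by
          exact_mod_cast congrArg (Rat.cast : ℚ → K) (Rat.den_mul_eq_num q)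
        rw [Algebra.smul_def, eq_ratCast, ← hq]
        push_cast
        ring
      rw [this]
      exact mul_mem (intCast_mem O _) hx
  refine IsFractionRing.of_field O K fun z => ?_
  obtain ⟨n, hn, hz⟩ := key z
  refine ⟨⟨_, hz⟩, n, ?_⟩
  have hn' : (n : K) ≠ 0 := mod_cast hn
  change z = ((n : K) * z) / ((n : O) : K)
  push_cast
  field_simp

variable (K O) in
/-- The elements of `M(O, m)`, as a submonoid of the group of invertible fractional ideals. -/
def Msubmonoid (m : ℕ) : Submonoid (Frac K O)ˣ where
  carrier := {u | ∃ a ∈ Mset K O m, (u : Frac K O) = a}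
  one_mem' := by
    refine ⟨⊤, ⟨top_ne_bot, top_sup_eq _, ?_⟩, ?_⟩
    · rw [FractionalIdeal.coeIdeal_top]
      exact isUnit_one
    · rw [FractionalIdeal.coeIdeal_top, Units.val_one]
  mul_mem' := by
    rintro u v ⟨a, ⟨ha0, ha, hau⟩, hu⟩ ⟨b, ⟨hb0, hb, hbu⟩, hv⟩
    refine ⟨a * b, ⟨mul_ne_zero ha0 hb0, Ideal.sup_span_singleton_mul_eq_top ha hb, ?_⟩, ?_⟩
    · rw [FractionalIdeal.coeIdeal_mul]
      exact hau.mul hbu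
    · rw [FractionalIdeal.coeIdeal_mul, Units.val_mul, hu, hv]

end Orders

theorem statement5 (K : Type) [Field K] [NumberField K]
    (O : Subalgebra ℤ K) (hO : IsImagQuadOrder K O) (N : ℕ) (hN : 0 < N) :
    -- φ maps M(O, ℓ_O N) into M(O_K, ℓ_O N)
    (∀ a ∈ Mset K O (condOrder K O * N),
        extIdeal K O a ∈ Mset K (integralClosure ℤ K) (condOrder K O * N)) ∧
    -- φ is multiplicative
    (∀ a ∈ Mset K O (condOrder K O * N), ∀ b ∈ Mset K O (condOrder K O * N),
        extIdeal K O (a * b) = extIdeal K O a * extIdeal K O b) ∧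
    -- φ is injective, with inverse given by contraction `𝔟 ↦ 𝔟 ∩ O` :
    (∀ a ∈ Mset K O (condOrder K O * N),
        (a : Set (O : Type)) =
          {x : (O : Type) | (x : K) ∈ Subtype.val '' ((extIdeal K O a : Ideal _) :
            Set ((integralClosure ℤ K : Subalgebra ℤ K) : Type))}) ∧
    -- φ is surjective onto M(O_K, ℓ_O N), the preimage of `𝔟` being `𝔟 ∩ O` :
    (∀ b ∈ Mset K (integralClosure ℤ K) (condOrder K O * N),
        ∃ a ∈ Mset K O (condOrder K O * N),
          extIdeal K O a = b ∧
          (a : Set (O : Type)) =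
            {x : (O : Type) | (x : K) ∈ Subtype.val '' ((b : Ideal _) :
              Set ((integralClosure ℤ K : Subalgebra ℤ K) : Type))}) ∧
    -- φ extends uniquely to a group isomorphism I(O, ℓ_O N) ≅ I(O_K, ℓ_O N), via
    -- 𝔞𝔠⁻¹ ↦ (𝔞O_K)(𝔠O_K)⁻¹ :
    (∃! e : (Igrp K O (condOrder K O * N)) ≃*
        (Igrp K (integralClosure ℤ K) (condOrder K O * N)),
      ∀ a c : Ideal O, a ∈ Mset K O (condOrder K O * N) → c ∈ Mset K O (condOrder K O * N) →
        ∀ u v : (Frac K O)ˣ, (u : Frac K O) = a → (v : Frac K O) = c →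
          ∀ hu : u * v⁻¹ ∈ Igrp K O (condOrder K O * N),
            ∀ w x : (Frac K (integralClosure ℤ K))ˣ,
              (w : Frac K (integralClosure ℤ K)) = extIdeal K O a →
              (x : Frac K (integralClosure ℤ K)) = extIdeal K O c →
                ∀ hw : w * x⁻¹ ∈ Igrp K (integralClosure ℤ K) (condOrder K O * N),
                  e ⟨u * v⁻¹, hu⟩ = ⟨w * x⁻¹, hw⟩) := by
  set m := condOrder K O * N with hm_def
  have hle := hO.le_integralClosure
  have := hO.isFractionRing
  have : IsFractionRing (integralClosure ℤ K) K :=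
    integralClosure.isFractionRing_of_finite_extension ℚ K
  set f : O →+* integralClosure ℤ K := (Subalgebra.inclusion hle).toRingHom with hf_def
  have hf : Function.Injective f := Subalgebra.inclusion_injective hle
  have hfm : f (m : O) = (m : integralClosure ℤ K) := map_natCast f m
  have hm : ∀ b : integralClosure ℤ K, ∃ a : O, f a = f (m : O) * b := fun b =>
    ⟨⟨_, natCast_condOrder_mul_mem b N⟩, by rw [hfm]; exact Subtype.ext (by simp [f, m])⟩
  have hext : ∀ a : Ideal O, extIdeal K O a = a.map f := extIdeal_eq_map hle
  have hnzd : O⁰ ≤ Submonoid.comap f (integralClosure ℤ K)⁰ :=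
    nonZeroDivisors_le_comap_nonZeroDivisors_of_injective f hf
  let E : Frac K O →+* Frac K (integralClosure ℤ K) := FractionalIdeal.extendedHom' K hnzd
  have hE : ∀ a : Ideal O, E (a : Frac K O) =
      ((a.map f : Ideal (integralClosure ℤ K)) : Frac K (integralClosure ℤ K)) :=
    fun a => FractionalIdeal.extended_coeIdeal_eq_map K hnzd a
  have hmaps : ∀ a ∈ Mset K O m, a.map f ∈ Mset K (integralClosure ℤ K) m := by
    rintro a ⟨ha0, ha, hau⟩
    refine ⟨fun h => ha0 ((Ideal.map_eq_bot_iff_of_injective hf).mp h), ?_, hE a ▸ hau.map E⟩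
    rw [primeTo, ← hfm]
    exact Ideal.map_sup_span_singleton_eq_top ha
  have hcomap : ∀ a ∈ Mset K O m, (a.map f).comap f = a := fun a ha =>
    Ideal.comap_map_eq_of_sup_span_singleton_eq_top hf hm ha.2.1
  have hsurj : ∀ b ∈ Mset K (integralClosure ℤ K) m,
      b.comap f ∈ Mset K O m ∧ (b.comap f).map f = b := by
    rintro b ⟨hb0, hb, hbu⟩
    rw [primeTo, ← hfm] at hb
    exact ⟨⟨Ideal.comap_ne_zero_of_sup_span_singleton_eq_top hm hb hb0,
      Ideal.comap_sup_span_singleton_eq_top hm hb,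
      Ideal.isUnit_comap_of_sup_span_singleton_eq_top (fun _ => rfl) hm hb hb0 hbu⟩,
      Ideal.map_comap_eq_of_sup_span_singleton_eq_top hm hb⟩
  have hbij : Set.BijOn (Units.map (E : Frac K O →* Frac K (integralClosure ℤ K)))
      (Msubmonoid K O m) (Msubmonoid K (integralClosure ℤ K) m) := by
    refine ⟨?_, ?_, ?_⟩
    · rintro u ⟨a, ha, hu⟩
      exact ⟨a.map f, hmaps a ha, by rw [← hE, ← hu]; rfl⟩
    · rintro u ⟨a, ha, hu⟩ v ⟨c, hc, hv⟩ huv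
      have h : E u = E v := congrArg Units.val huv
      rw [hu, hv, hE, hE, FractionalIdeal.coeIdeal_inj] at h
      have hac : a = c := by rw [← hcomap a ha, h, hcomap c hc]
      exact Units.ext (by rw [hu, hv, hac])
    · rintro w ⟨b, hb, hw⟩
      obtain ⟨hmem, heq⟩ := hsurj b hb
      refine ⟨hmem.2.2.unit, ⟨_, hmem, rfl⟩, Units.ext ?_⟩
      exact (hE _).trans (by rw [heq, hw])
  obtain ⟨e, he⟩ := MonoidHom.exists_mulEquiv_closure _ (Msubmonoid K O m) hbij
  refine ⟨fun a ha => hext a ▸ hmaps a ha, fun a _ b _ => ?_, fun a ha => ?_, fun b hb => ?_,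
    e, ?_, fun e' he' => ?_⟩
  · rw [hext, hext, hext, Ideal.map_mul]
  · rw [setOf_mem_image_val_eq_comap hle, hext, hcomap a ha]
  · exact ⟨b.comap f, (hsurj b hb).1, (hext _).trans (hsurj b hb).2,
      (setOf_mem_image_val_eq_comap hle b).symm⟩
  · intro a c _ _ u v hu hv huv w x hw hx _
    refine Subtype.ext ((he _).trans ?_)
    change Units.map (E : Frac K O →* Frac K (integralClosure ℤ K)) (u * v⁻¹) = w * x⁻¹
    have hw' : Units.map (E : Frac K O →* Frac K (integralClosure ℤ K)) u = w :=
      Units.ext (by rw [hw, hext, ← hE, ← hu]; rfl)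
    have hx' : Units.map (E : Frac K O →* Frac K (integralClosure ℤ K)) v = x :=
      Units.ext (by rw [hx, hext, ← hE, ← hv]; rfl)
    rw [map_mul, map_inv, hw', hx']
  · refine MulEquiv.ext ?_
    rintro ⟨y, hy⟩
    obtain ⟨u, ⟨a, ha, hu⟩, v, ⟨c, hc, hv⟩, rfl⟩ :=
      (Msubmonoid K O m).exists_mul_inv_of_mem_closure hy
    have hval : (e ⟨u * v⁻¹, hy⟩ : (Frac K (integralClosure ℤ K))ˣ) =
        Units.map (E : Frac K O →* Frac K (integralClosure ℤ K)) u *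
          (Units.map (E : Frac K O →* Frac K (integralClosure ℤ K)) v)⁻¹ := by
      rw [he, ← map_inv, ← map_mul]
    have hmem : Units.map (E : Frac K O →* Frac K (integralClosure ℤ K)) u *
          (Units.map (E : Frac K O →* Frac K (integralClosure ℤ K)) v)⁻¹ ∈
        Igrp K (integralClosure ℤ K) m := hval ▸ (e ⟨u * v⁻¹, hy⟩).2
    refine (he' a c ha hc u v hu hv hy _ _ ?_ ?_ hmem).trans (Subtype.ext hval.symm)
    · rw [hext, ← hE, ← hu]; rfl
    · rw [hext, ← hE, ← hv]; rfl
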